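/- Let ζ_{0,j}, ζ_{1,j} (j = 1,…,k) be real numbers such that for each i = 0,1 the sequence ζ_{i,j} is nonincreasing in j, and for nonempty V ⊆ J let ζ(V) ∈ ℝ^{k+1} have 0-th entry ζ_{0,|V|}, i-th entry ζ_{1,|V|} for i ∈ V, and i-th entry 0 for i ∈ J∖V. Assume (C1): γ_{+U}(ζ(V)) < 1 and γ_{0U}(ζ(V)) < 1 for every nonempty V ⊆ J with |V| ≤ k−1 and every nonempty U ⊆ J with U ∩ V = ∅. Then the condition (C2): φ_{+U}(ζ(V)) < ∞ for every V with |V| = 1 and every nonempty U ⊆ J with U ∩ V ≠ ∅, implies φ(ζ_{0,1}, ζ_{1,k−1}𝟙) < ∞. -/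

import Mathlib

open Filter Topology
open scoped ENNReal

noncomputable section

/-- Traffic intensity ρ = λ / Σ μᵢ. -/
def rho (k : ℕ) (lam : ℝ) (μ : Fin k → ℝ) : ℝ := lam / ∑ i, μ i

/-- Index set of the shortest queues: the zero coordinates of the difference vector. -/
def zeroSet (k : ℕ) (y : Fin k → ℕ) : Finset (Fin k) :=
  Finset.univ.filter (fun i => y i = 0)

/-- One-step transition probability of the uniformized JSQ chain `Z = (M, Y)` on
`ℕ × (Fin k → ℕ)`, where `M` is the minimum queue length and `Y` the vector of
differences from the minimum. -/
def jsqP (k : ℕ) (lam : ℝ) (μ : Fin k → ℝ) (s s' : ℕ × (Fin k → ℕ)) : ℝ :=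
  (if (zeroSet k s.2).card = 1 then
      (if s' = (s.1 + 1, fun j => s.2 j - 1) then lam else 0)
    else
      ∑ i ∈ zeroSet k s.2,
        (if s' = (s.1, Function.update s.2 i 1) then lam / (zeroSet k s.2).card else 0))
  + (∑ j ∈ (zeroSet k s.2)ᶜ,
      (if s' = (s.1, Function.update s.2 j (s.2 j - 1)) then μ j else 0))
  + (∑ i ∈ zeroSet k s.2,
      (if s' = (if s.1 = 0 then s else (s.1 - 1, fun j => if j = i then 0 else s.2 j + 1))
        then μ i else 0))

/-- The exponential weight `e^{θ·Z}` for `θ ∈ ℝ^{k+1}` and a state `Z = (m, y)`. -/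
def expWeight (k : ℕ) (θ : Fin (k + 1) → ℝ) (s : ℕ × (Fin k → ℕ)) : ℝ :=
  Real.exp (θ 0 * (s.1 : ℝ) + ∑ i : Fin k, θ i.succ * (s.2 i : ℝ))

/-- The stationary moment generating function `φ(θ) = E[e^{θ·Z}] ∈ [0,∞]`. -/
def phi (k : ℕ) (π : ℕ × (Fin k → ℕ) → ℝ) (θ : Fin (k + 1) → ℝ) : ℝ≥0∞ :=
  ∑' s : ℕ × (Fin k → ℕ), ENNReal.ofReal (π s * expWeight k θ s)

/-- `φ_{+U}(θ) = E[e^{θ·Z} 1(Z ∈ S_{+U})]`. -/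
def phiPlus (k : ℕ) (π : ℕ × (Fin k → ℕ) → ℝ) (U : Finset (Fin k))
    (θ : Fin (k + 1) → ℝ) : ℝ≥0∞ :=
  ∑' s : ℕ × (Fin k → ℕ),
    if 1 ≤ s.1 ∧ zeroSet k s.2 = U then ENNReal.ofReal (π s * expWeight k θ s) else 0

/-- `φ_{0U}(θ) = E[e^{θ·Z} 1(Z ∈ S_{0U})]`. -/
def phiZero (k : ℕ) (π : ℕ × (Fin k → ℕ) → ℝ) (U : Finset (Fin k))
    (θ : Fin (k + 1) → ℝ) : ℝ≥0∞ :=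
  ∑' s : ℕ × (Fin k → ℕ),
    if s.1 = 0 ∧ zeroSet k s.2 = U then ENNReal.ofReal (π s * expWeight k θ s) else 0

/-- The mgf `γ_{+U}(θ)` of the one-step increment from states in `S_{+U}`. -/
def gammaPlus (k : ℕ) (lam : ℝ) (μ : Fin k → ℝ) (U : Finset (Fin k))
    (θ : Fin (k + 1) → ℝ) : ℝ :=
  (if U.card = 1 then lam * Real.exp (θ 0 - ∑ j ∈ Uᶜ, θ j.succ)
    else ∑ i ∈ U, (lam / U.card) * Real.exp (θ i.succ))
  + ∑ j ∈ Uᶜ, μ j * Real.exp (-θ j.succ)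
  + ∑ i ∈ U, μ i * Real.exp (-θ 0 + ∑ j ∈ Finset.univ.erase i, θ j.succ)

/-- The mgf `γ_{0U}(θ)` of the one-step increment from states in `S_{0U}`. -/
def gammaZero (k : ℕ) (lam : ℝ) (μ : Fin k → ℝ) (U : Finset (Fin k))
    (θ : Fin (k + 1) → ℝ) : ℝ :=
  (if U.card = 1 then lam * Real.exp (θ 0 - ∑ j ∈ Uᶜ, θ j.succ)
    else ∑ i ∈ U, (lam / U.card) * Real.exp (θ i.succ))
  + ∑ j ∈ Uᶜ, μ j * Real.exp (-θ j.succ)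
  + ∑ i ∈ U, μ i

end


noncomputable section

/-- The vector `ζ(V) ∈ ℝ^{k+1}` with 0-th entry `ζ_{0,|V|}`, entry `ζ_{1,|V|}` on `V`,
and `0` off `V`. -/
def zetaVec (k : ℕ) (ζ₀ ζ₁ : ℕ → ℝ) (V : Finset (Fin k)) : Fin (k + 1) → ℝ :=
  Fin.cons (ζ₀ V.card) (fun i => if i ∈ V then ζ₁ V.card else 0)

end


/-- Foster–Lyapunov moment bound: if `f` contracts in one step on `G`, grows at most by a constant
factor elsewhere, and has finite mean off `G`, then it has finite stationary mean. -/
lemma tsum_mul_ne_top_of_drift {S : Type*} (p f : S → ℝ≥0∞) (Q : S → S → ℝ≥0∞)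
    (G : Set S) (c K : ℝ≥0∞) (hp : ∑' s, p s ≠ ⊤)
    (hstat : ∀ s', ∑' s, p s * Q s s' = p s')
    (hQ : ∀ s, p s ≠ 0 → ∑' s', Q s s' ≤ 1)
    (hf : ∀ s, f s ≠ ⊤) (hc : c < 1) (hK : K ≠ ⊤)
    (hG : ∀ s ∈ G, p s ≠ 0 → ∑' s', Q s s' * f s' ≤ c * f s)
    (hGc : ∀ s, p s ≠ 0 → ∑' s', Q s s' * f s' ≤ K * f s)
    (hB : ∑' s, Gᶜ.indicator (fun s => p s * f s) s ≠ ⊤) :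
    ∑' s, p s * f s ≠ ⊤ := by
  classical
  set B := ∑' s, Gᶜ.indicator (fun s => p s * f s) s with hBdef
  have key : ∀ N : ℝ≥0∞, N ≠ ⊤ →
      ∑' s, G.indicator (fun s => if f s ≤ N then p s * ((1 - c) * f s) else 0) s ≤ K * B := by
    intro N hN
    set F := ∑' s, p s * min (f s) N with hF
    have hFtop : F ≠ ⊤ := by
      refine ne_top_of_le_ne_top (ENNReal.mul_ne_top hp hN) ?_
      rw [← ENNReal.tsum_mul_right]
      exact ENNReal.tsum_le_tsum fun s => by gcongr; exact min_le_right _ _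
    have hFQ : F = ∑' s, p s * ∑' s', Q s s' * min (f s') N := by
      calc F = ∑' s', (∑' s, p s * Q s s') * min (f s') N := by simp_rw [hstat, hF]
        _ = ∑' s', ∑' s, p s * (Q s s' * min (f s') N) := by
            refine tsum_congr fun s' => ?_
            rw [← ENNReal.tsum_mul_right]
            exact tsum_congr fun s => mul_assoc _ _ _
        _ = _ := by
            rw [ENNReal.tsum_comm]
            exact tsum_congr fun s => ENNReal.tsum_mul_left
    have hmain : (∑' s, G.indicator (fun s => if f s ≤ N then p s * ((1 - c) * f s) else 0) s)
        + F ≤ K * B + F := by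
      conv_lhs => rw [hFQ]
      rw [hBdef, hF, ← ENNReal.tsum_mul_left, ← ENNReal.tsum_add, ← ENNReal.tsum_add]
      refine ENNReal.tsum_le_tsum fun s => ?_
      by_cases hps : p s = 0
      · simp [hps, Set.indicator_apply]
      have h1 : ∑' s', Q s s' * min (f s') N ≤ ∑' s', Q s s' * f s' :=
        ENNReal.tsum_le_tsum fun s' => by gcongr; exact min_le_left _ _
      have h2 : ∑' s', Q s s' * min (f s') N ≤ N := by
        calc _ ≤ ∑' s', Q s s' * N :=
              ENNReal.tsum_le_tsum fun s' => by gcongr; exact min_le_right _ _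
          _ = (∑' s', Q s s') * N := ENNReal.tsum_mul_right
          _ ≤ 1 * N := by gcongr; exact hQ s hps
          _ = N := one_mul _
      by_cases hs : s ∈ G
      · have h3 := h1.trans (hG s hs hps)
        rw [Set.indicator_of_mem hs, Set.indicator_of_notMem (by simpa using hs), mul_zero,
          zero_add]
        split_ifs with hfN
        · rw [← mul_add, min_eq_left hfN]
          gcongr
          calc _ ≤ (1 - c) * f s + c * f s := by gcongr
            _ = f s := by rw [← add_mul, tsub_add_cancel_of_le hc.le, one_mul]
        · rw [zero_add, min_eq_right (not_le.mp hfN).le]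
          gcongr
      · have h3 := h1.trans (hGc s hps)
        rw [Set.indicator_of_notMem hs, Set.indicator_of_mem (by simpa using hs), zero_add]
        calc _ ≤ p s * (K * f s) := by gcongr
          _ = K * (p s * f s) := by ring
          _ ≤ _ := le_self_add
    exact (ENNReal.add_le_add_iff_right hFtop).mp hmain
  have hKB : K * B ≠ ⊤ := ENNReal.mul_ne_top hK hB
  have hgood : (1 - c) * ∑' s, G.indicator (fun s => p s * f s) s ≤ K * B := by
    rw [← ENNReal.tsum_mul_left, ENNReal.tsum_eq_iSup_sum]
    refine iSup_le fun T => ?_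
    refine le_trans ?_ (key (∑ s ∈ T, f s) (ENNReal.sum_ne_top.mpr fun s _ => hf s))
    refine le_trans (Finset.sum_le_sum fun s hs => ?_) (ENNReal.sum_le_tsum T)
    have hle : f s ≤ ∑ s ∈ T, f s := Finset.single_le_sum (fun _ _ => zero_le) hs
    by_cases hsG : s ∈ G
    · simp only [Set.indicator_of_mem hsG, if_pos hle]
      exact le_of_eq (by ring)
    · simp [Set.indicator_of_notMem hsG]
  have hGfin : ∑' s, G.indicator (fun s => p s * f s) s ≠ ⊤ := by
    intro h
    rw [h, ENNReal.mul_top (tsub_pos_of_lt hc).ne'] at hgood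
    exact hKB (top_le_iff.mp hgood)
  have hsplit : ∑' s, p s * f s = (∑' s, G.indicator (fun s => p s * f s) s) + B := by
    rw [hBdef, ← ENNReal.tsum_add]
    refine tsum_congr fun s => ?_
    exact (congrFun (Set.indicator_self_add_compl G fun s => p s * f s) s).symm
  rw [hsplit]
  exact ENNReal.add_ne_top.mpr ⟨hGfin, hB⟩

lemma mem_zeroSet {k : ℕ} {y : Fin k → ℕ} {i : Fin k} : i ∈ zeroSet k y ↔ y i = 0 := by
  simp [zeroSet]

lemma hasSum_jsqP_mul (k : ℕ) (lam : ℝ) (μ : Fin k → ℝ) (s : ℕ × (Fin k → ℕ))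
    (g : ℕ × (Fin k → ℕ) → ℝ) :
    HasSum (fun s' => jsqP k lam μ s s' * g s')
      ((if (zeroSet k s.2).card = 1 then lam * g (s.1 + 1, fun j => s.2 j - 1)
        else ∑ i ∈ zeroSet k s.2,
          lam / (zeroSet k s.2).card * g (s.1, Function.update s.2 i 1))
      + (∑ j ∈ (zeroSet k s.2)ᶜ, μ j * g (s.1, Function.update s.2 j (s.2 j - 1)))
      + ∑ i ∈ zeroSet k s.2, μ i *
        g (if s.1 = 0 then s else (s.1 - 1, fun j => if j = i then 0 else s.2 j + 1))) := by
  have hpt : ∀ (a : ℕ × (Fin k → ℕ)) (r : ℝ),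
      HasSum (fun s' => (if s' = a then r else 0) * g s') (r * g a) := by
    intro a r
    convert hasSum_ite_eq a (r * g a) using 2 with s'
    split_ifs with h
    · rw [h]
    · rw [zero_mul]
  simp only [jsqP, add_mul, Finset.sum_mul]
  refine ((?_ : HasSum _ _).add (hasSum_sum fun j _ => hpt _ _)).add
    (hasSum_sum fun i _ => hpt _ _)
  split_ifs with h
  · exact hpt _ _
  · simp only [Finset.sum_mul]
    exact hasSum_sum fun i _ => hpt _ _

lemma expWeight_arrival (k : ℕ) (θ : Fin (k + 1) → ℝ) (m : ℕ) (y : Fin k → ℕ) :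
    expWeight k θ (m + 1, fun j => y j - 1) =
      Real.exp (θ 0 - ∑ j ∈ (zeroSet k y)ᶜ, θ j.succ) * expWeight k θ (m, y) := by
  have h : ∑ j, θ j.succ * ((y j - 1 : ℕ) : ℝ) =
      ∑ j, θ j.succ * (y j : ℝ) - ∑ j ∈ (zeroSet k y)ᶜ, θ j.succ := by
    rw [← Finset.univ_inter (zeroSet k y)ᶜ, ← Finset.sum_ite_mem, ← Finset.sum_sub_distrib]
    refine Finset.sum_congr rfl fun j _ => ?_
    rcases Nat.eq_zero_or_pos (y j) with hj | hj
    · simp [mem_zeroSet, hj]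
    · rw [if_pos (by simp [mem_zeroSet, hj.ne']), Nat.cast_sub hj]
      push_cast
      ring
  rw [expWeight, expWeight, ← Real.exp_add]
  simp only [h]
  push_cast
  ring_nf

lemma expWeight_update (k : ℕ) (θ : Fin (k + 1) → ℝ) (m : ℕ) (y : Fin k → ℕ) (i : Fin k)
    (n : ℕ) :
    expWeight k θ (m, Function.update y i n) =
      Real.exp (θ i.succ * ((n : ℝ) - y i)) * expWeight k θ (m, y) := by
  have h : ∑ j, θ j.succ * ((Function.update y i n j : ℕ) : ℝ) =
      ∑ j, θ j.succ * (y j : ℝ) + θ i.succ * ((n : ℝ) - y i) := by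
    rw [← Finset.add_sum_erase _ _ (Finset.mem_univ i),
      ← Finset.add_sum_erase _ (fun j => θ j.succ * (y j : ℝ)) (Finset.mem_univ i),
      Finset.sum_congr rfl fun j hj => by
        rw [Function.update_of_ne (Finset.ne_of_mem_erase hj)]]
    simp only [Function.update_self]
    ring
  rw [expWeight, expWeight, ← Real.exp_add]
  simp only [h]
  ring_nf

lemma expWeight_departure (k : ℕ) (θ : Fin (k + 1) → ℝ) (m : ℕ) (y : Fin k → ℕ) (i : Fin k)
    (hm : m ≠ 0) (hi : y i = 0) :
    expWeight k θ (m - 1, fun j => if j = i then 0 else y j + 1) =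
      Real.exp (-θ 0 + ∑ j ∈ Finset.univ.erase i, θ j.succ) * expWeight k θ (m, y) := by
  have h : ∑ j, θ j.succ * ((if j = i then 0 else y j + 1 : ℕ) : ℝ) =
      ∑ j, θ j.succ * (y j : ℝ) + ∑ j ∈ Finset.univ.erase i, θ j.succ := by
    rw [← Finset.add_sum_erase _ _ (Finset.mem_univ i),
      ← Finset.add_sum_erase _ (fun j => θ j.succ * (y j : ℝ)) (Finset.mem_univ i),
      Finset.sum_congr rfl fun j hj => by rw [if_neg (Finset.ne_of_mem_erase hj)]]
    simp [hi, mul_add, Finset.sum_add_distrib]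
  rw [expWeight, expWeight, ← Real.exp_add]
  simp only [h]
  rw [Nat.cast_sub (Nat.one_le_iff_ne_zero.mpr hm)]
  push_cast
  ring_nf

lemma hasSum_jsqP_mul_expWeight (k : ℕ) (lam : ℝ) (μ : Fin k → ℝ) (θ : Fin (k + 1) → ℝ)
    (s : ℕ × (Fin k → ℕ)) :
    HasSum (fun s' => jsqP k lam μ s s' * expWeight k θ s')
      ((if s.1 = 0 then gammaZero k lam μ (zeroSet k s.2) θ
        else gammaPlus k lam μ (zeroSet k s.2) θ) * expWeight k θ s) := by
  convert hasSum_jsqP_mul k lam μ s (expWeight k θ) using 1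
  obtain ⟨m, y⟩ := s
  have h1 : ∀ i ∈ zeroSet k y, expWeight k θ (m, Function.update y i 1) =
      Real.exp (θ i.succ) * expWeight k θ (m, y) := by
    intro i hi
    simp [expWeight_update, mem_zeroSet.mp hi]
  have h2 : ∀ j ∈ (zeroSet k y)ᶜ, expWeight k θ (m, Function.update y j (y j - 1)) =
      Real.exp (-θ j.succ) * expWeight k θ (m, y) := by
    intro j hj
    have hj' : 1 ≤ y j := by
      rw [Finset.mem_compl, mem_zeroSet] at hj
      omega
    rw [expWeight_update, Nat.cast_sub hj']
    push_cast
    ring_nf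
  have hA : (if (zeroSet k y).card = 1 then lam * expWeight k θ (m + 1, fun j => y j - 1)
        else ∑ i ∈ zeroSet k y,
          lam / (zeroSet k y).card * expWeight k θ (m, Function.update y i 1)) =
      (if (zeroSet k y).card = 1 then
          lam * Real.exp (θ 0 - ∑ j ∈ (zeroSet k y)ᶜ, θ j.succ)
        else ∑ i ∈ zeroSet k y, (lam / (zeroSet k y).card) * Real.exp (θ i.succ))
        * expWeight k θ (m, y) := by
    split_ifs
    · rw [expWeight_arrival, mul_assoc]
    · rw [Finset.sum_mul]
      exact Finset.sum_congr rfl fun i hi => by rw [h1 i hi, mul_assoc]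
  have hB : ∑ j ∈ (zeroSet k y)ᶜ, μ j * expWeight k θ (m, Function.update y j (y j - 1)) =
      (∑ j ∈ (zeroSet k y)ᶜ, μ j * Real.exp (-θ j.succ)) * expWeight k θ (m, y) := by
    rw [Finset.sum_mul]
    exact Finset.sum_congr rfl fun j hj => by rw [h2 j hj, mul_assoc]
  dsimp only
  rw [hA, hB]
  by_cases hm : m = 0
  · simp only [hm, if_true, gammaZero, add_mul, Finset.sum_mul]
  · simp only [hm, if_false, gammaPlus, add_mul]
    congr 1
    rw [Finset.sum_mul]
    exact Finset.sum_congr rfl fun i hi => by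
      rw [expWeight_departure k θ m y i hm (mem_zeroSet.mp hi), mul_assoc]

lemma jsqP_nonneg (k : ℕ) (lam : ℝ) (μ : Fin k → ℝ) (hlam : 0 ≤ lam) (hμ : ∀ i, 0 ≤ μ i)
    (s s' : ℕ × (Fin k → ℕ)) : 0 ≤ jsqP k lam μ s s' := by
  unfold jsqP
  refine add_nonneg (add_nonneg ?_ (Finset.sum_nonneg fun j _ => ?_))
    (Finset.sum_nonneg fun i _ => ?_)
  · split_ifs
    · exact hlam
    · exact le_rfl
    · exact Finset.sum_nonneg fun i _ => by split_ifs <;> positivity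
  all_goals
    split_ifs
    all_goals first | exact hμ _ | exact le_rfl

lemma hasSum_jsqP (k : ℕ) (lam : ℝ) (μ : Fin k → ℝ) (hnorm : lam + ∑ i, μ i = 1)
    (s : ℕ × (Fin k → ℕ)) (hs : (zeroSet k s.2).Nonempty) :
    HasSum (fun s' => jsqP k lam μ s s') 1 := by
  have h := hasSum_jsqP_mul k lam μ s fun _ => 1
  simp only [mul_one, Finset.sum_const, nsmul_eq_mul] at h
  convert h using 1
  have hne : ((zeroSet k s.2).card : ℝ) ≠ 0 := by exact_mod_cast hs.card_ne_zero
  rw [mul_div_cancel₀ _ hne, ite_self, add_assoc, Finset.sum_compl_add_sum, hnorm]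

lemma expWeight_pos (k : ℕ) (θ : Fin (k + 1) → ℝ) (s : ℕ × (Fin k → ℕ)) :
    0 < expWeight k θ s := Real.exp_pos _

lemma phi_lt_top_of_drift (k : ℕ) (lam : ℝ) (μ : Fin k → ℝ)
    (hlam : 0 < lam) (hμ : ∀ i, 0 < μ i) (hnorm : lam + ∑ i, μ i = 1)
    (π : ℕ × (Fin k → ℕ) → ℝ) (hπnn : ∀ s, 0 ≤ π s)
    (hπsupp : ∀ s, π s ≠ 0 → ∃ i : Fin k, s.2 i = 0) (hπsum : HasSum π 1)
    (hπstat : ∀ s', (∑' s, π s * jsqP k lam μ s s') = π s')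
    (θ : Fin (k + 1) → ℝ) (V : Finset (Fin k))
    (hC1 : ∀ U : Finset (Fin k), U.Nonempty → U ∩ V = ∅ →
      gammaPlus k lam μ U θ < 1 ∧ gammaZero k lam μ U θ < 1)
    (hB : ∑' s : ℕ × (Fin k → ℕ),
      (if (zeroSet k s.2 ∩ V).Nonempty then ENNReal.ofReal (π s * expWeight k θ s) else 0) < ⊤) :
    phi k π θ < ⊤ := by
  classical
  have hPnn := jsqP_nonneg k lam μ hlam.le fun i => (hμ i).le
  have hne : ∀ s, ENNReal.ofReal (π s) ≠ 0 → (zeroSet k s.2).Nonempty := by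
    intro s hs
    obtain ⟨i, hi⟩ := hπsupp s fun h => hs (by simp [h])
    exact ⟨i, mem_zeroSet.mpr hi⟩
  have hrow : ∀ s, π s ≠ 0 → HasSum (fun s' => jsqP k lam μ s s') 1 := by
    intro s hs
    obtain ⟨i, hi⟩ := hπsupp s hs
    exact hasSum_jsqP k lam μ hnorm s ⟨i, mem_zeroSet.mpr hi⟩
  have hstep : ∀ s, ∑' s', ENNReal.ofReal (jsqP k lam μ s s') *
      ENNReal.ofReal (expWeight k θ s') =
      ENNReal.ofReal (if s.1 = 0 then gammaZero k lam μ (zeroSet k s.2) θ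
        else gammaPlus k lam μ (zeroSet k s.2) θ) * ENNReal.ofReal (expWeight k θ s) := by
    intro s
    have h := hasSum_jsqP_mul_expWeight k lam μ θ s
    rw [← ENNReal.ofReal_mul' (expWeight_pos k θ s).le, ← h.tsum_eq,
      ENNReal.ofReal_tsum_of_nonneg
        (fun s' => mul_nonneg (hPnn s s') (expWeight_pos k θ s').le) h.summable]
    exact tsum_congr fun s' => (ENNReal.ofReal_mul (hPnn s s')).symm
  have hsplit : ∀ s, ENNReal.ofReal (π s * expWeight k θ s) =
      ENNReal.ofReal (π s) * ENNReal.ofReal (expWeight k θ s) :=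
    fun s => ENNReal.ofReal_mul (hπnn s)
  have hmain := tsum_mul_ne_top_of_drift (fun s => ENNReal.ofReal (π s))
    (fun s => ENNReal.ofReal (expWeight k θ s))
    (fun s s' => ENNReal.ofReal (jsqP k lam μ s s'))
    {s | zeroSet k s.2 ∩ V = ∅}
    (Finset.univ.sup fun U : Finset (Fin k) => if U.Nonempty ∧ U ∩ V = ∅ then
      max (ENNReal.ofReal (gammaPlus k lam μ U θ)) (ENNReal.ofReal (gammaZero k lam μ U θ))
      else 0)
    (Finset.univ.sup fun U : Finset (Fin k) =>
      max (ENNReal.ofReal (gammaPlus k lam μ U θ)) (ENNReal.ofReal (gammaZero k lam μ U θ)))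
    ?_ ?_ ?_ (fun _ => ENNReal.ofReal_ne_top) ?_ ?_ ?_ ?_ ?_
  · rw [phi, tsum_congr hsplit]
    exact hmain.lt_top
  · rw [← ENNReal.ofReal_tsum_of_nonneg hπnn hπsum.summable]
    exact ENNReal.ofReal_ne_top
  · intro s'
    have hsummable : Summable fun s => π s * jsqP k lam μ s s' := by
      refine Summable.of_nonneg_of_le (fun s => mul_nonneg (hπnn s) (hPnn s s')) (fun s => ?_)
        hπsum.summable
      by_cases hs : π s = 0
      · simp [hs]
      · exact mul_le_of_le_one_right (hπnn s)
          (le_hasSum (hrow s hs) s' fun j _ => hPnn s j)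
    rw [← hπstat s', ENNReal.ofReal_tsum_of_nonneg
      (fun s => mul_nonneg (hπnn s) (hPnn s s')) hsummable]
    exact tsum_congr fun s => (ENNReal.ofReal_mul (hπnn s)).symm
  · intro s hs
    have h := hrow s fun h => hs (by simp [h])
    rw [← ENNReal.ofReal_tsum_of_nonneg (hPnn s) h.summable, h.tsum_eq, ENNReal.ofReal_one]
  · rw [Finset.sup_lt_iff (by simp)]
    intro U _
    split_ifs with h
    · obtain ⟨h1, h2⟩ := hC1 U h.1 h.2
      exact max_lt (ENNReal.ofReal_lt_one.mpr h1) (ENNReal.ofReal_lt_one.mpr h2)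
    · exact zero_lt_one
  · refine ((Finset.sup_lt_iff (by simp)).mpr fun U _ => ?_).ne
    exact max_lt ENNReal.ofReal_lt_top ENNReal.ofReal_lt_top
  · intro s hs hps
    rw [hstep]
    gcongr
    refine le_trans ?_ (Finset.le_sup (Finset.mem_univ (zeroSet k s.2)))
    rw [if_pos (show (zeroSet k s.2).Nonempty ∧ zeroSet k s.2 ∩ V = ∅ from ⟨hne s hps, hs⟩)]
    split_ifs
    · exact le_max_right _ _
    · exact le_max_left _ _
  · intro s hps
    rw [hstep]
    gcongr
    refine le_trans ?_ (Finset.le_sup (Finset.mem_univ (zeroSet k s.2)))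
    split_ifs
    · exact le_max_right _ _
    · exact le_max_left _ _
  · refine ne_of_eq_of_ne (tsum_congr fun s => ?_) hB.ne
    simp only [Set.indicator_apply, Set.mem_compl_iff, Set.mem_ofPred_eq,
      ← Finset.nonempty_iff_ne_empty, ← ne_eq, hsplit]

lemma expWeight_cons (k : ℕ) (z t : ℝ) (V : Finset (Fin k)) (s : ℕ × (Fin k → ℕ)) :
    expWeight k (Fin.cons z fun i => if i ∈ V then t else 0) s =
      Real.exp (z * s.1 + t * ∑ i ∈ V, (s.2 i : ℝ)) := by
  simp [expWeight, ite_mul, Finset.sum_ite_mem, Finset.mul_sum]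

lemma sum_compl_rate (k : ℕ) (μ : Fin k → ℝ) (z t : ℝ) (U V : Finset (Fin k))
    (hUV : U ∩ V = ∅) :
    ∑ j ∈ Uᶜ, μ j * Real.exp
        (-(Fin.cons z (fun i => if i ∈ V then t else 0) : Fin (k + 1) → ℝ) j.succ) =
      (∑ j ∈ V, μ j) * Real.exp (-t) + ∑ j ∈ Uᶜ \ V, μ j := by
  have hsub : V ⊆ Uᶜ := by
    intro j hj
    rw [Finset.mem_compl]
    intro hjU
    simpa [hUV] using Finset.mem_inter.mpr ⟨hjU, hj⟩
  rw [← Finset.sum_sdiff hsub, add_comm, Finset.sum_mul]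
  congr 1
  · exact Finset.sum_congr rfl fun j hj => by simp [hj]
  · exact Finset.sum_congr rfl fun j hj => by simp [(Finset.mem_sdiff.mp hj).2]

lemma arrival_term_cons (k : ℕ) (lam : ℝ) (z t : ℝ) (U V : Finset (Fin k))
    (hU : U.Nonempty) (hUV : U ∩ V = ∅) :
    (if U.card = 1 then lam * Real.exp
        ((Fin.cons z (fun i => if i ∈ V then t else 0) : Fin (k + 1) → ℝ) 0 - ∑ j ∈ Uᶜ,
          (Fin.cons z (fun i => if i ∈ V then t else 0) : Fin (k + 1) → ℝ) j.succ)
      else ∑ i ∈ U, (lam / U.card) * Real.exp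
        ((Fin.cons z (fun i => if i ∈ V then t else 0) : Fin (k + 1) → ℝ) i.succ)) =
      if U.card = 1 then lam * Real.exp (z - V.card * t) else lam := by
  have hdisj : Disjoint U V := Finset.disjoint_iff_inter_eq_empty.mpr hUV
  have hsub : Uᶜ ∩ V = V := Finset.inter_eq_right.mpr fun j hj =>
    Finset.mem_compl.mpr fun h => Finset.disjoint_left.mp hdisj h hj
  split_ifs with h
  · simp [Finset.sum_ite_mem, hsub]
  · have hne : (U.card : ℝ) ≠ 0 := by exact_mod_cast hU.card_ne_zero
    rw [Finset.sum_congr rfl fun i hi => by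
      rw [Fin.cons_succ, if_neg (Finset.disjoint_left.mp hdisj hi), Real.exp_zero, mul_one],
      Finset.sum_const, nsmul_eq_mul, mul_div_cancel₀ _ hne]

lemma gammaZero_cons (k : ℕ) (lam : ℝ) (μ : Fin k → ℝ) (z t : ℝ) (U V : Finset (Fin k))
    (hU : U.Nonempty) (hUV : U ∩ V = ∅) :
    gammaZero k lam μ U (Fin.cons z fun i => if i ∈ V then t else 0) =
      ((if U.card = 1 then lam * Real.exp (z - V.card * t) else lam) + ∑ i ∈ U, μ i)
        + (∑ j ∈ V, μ j) * Real.exp (-t) + ∑ j ∈ Uᶜ \ V, μ j := by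
  rw [gammaZero, arrival_term_cons k lam z t U V hU hUV, sum_compl_rate k μ z t U V hUV]
  ring

lemma gammaPlus_cons (k : ℕ) (lam : ℝ) (μ : Fin k → ℝ) (z t : ℝ) (U V : Finset (Fin k))
    (hU : U.Nonempty) (hUV : U ∩ V = ∅) :
    gammaPlus k lam μ U (Fin.cons z fun i => if i ∈ V then t else 0) =
      ((if U.card = 1 then lam * Real.exp (z - V.card * t) else lam)
          + (∑ i ∈ U, μ i) * Real.exp (-(z - V.card * t)))
        + (∑ j ∈ V, μ j) * Real.exp (-t) + ∑ j ∈ Uᶜ \ V, μ j := by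
  have h : ∑ i ∈ U, μ i * Real.exp
      (-(Fin.cons z (fun i => if i ∈ V then t else 0) : Fin (k + 1) → ℝ) 0 +
        ∑ j ∈ Finset.univ.erase i,
          (Fin.cons z (fun i => if i ∈ V then t else 0) : Fin (k + 1) → ℝ) j.succ) =
      (∑ i ∈ U, μ i) * Real.exp (-(z - V.card * t)) := by
    rw [Finset.sum_mul]
    refine Finset.sum_congr rfl fun i hi => ?_
    have hiV : i ∉ V := fun h => by simpa [hUV] using Finset.mem_inter.mpr ⟨hi, h⟩
    have herase : Finset.univ.erase i ∩ V = V := Finset.inter_eq_right.mpr fun j hj => by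
      simp only [Finset.mem_erase, Finset.mem_univ, and_true]
      rintro rfl
      exact hiV hj
    simp only [Fin.cons_zero, Fin.cons_succ, Finset.sum_ite_mem, herase, Finset.sum_const,
      nsmul_eq_mul]
    ring_nf
  rw [gammaPlus, arrival_term_cons k lam z t U V hU hUV, sum_compl_rate k μ z t U V hUV, h]
  ring

/-- A contraction condition for singletons and for `V` persists on `V` after raising the
zeroth exponent to the value used for singletons. -/
lemma drift_interpolation {ι : Type*} [DecidableEq ι] (h : ℝ → ℝ)
    (hconv : ConvexOn ℝ Set.univ h)
    (μ : ι → ℝ) (hμ : ∀ i, 0 ≤ μ i) (V W : Finset ι) (hV : V.Nonempty) (hVW : V ⊆ W)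
    (z₁ t₁ z t : ℝ) (hz : z ≤ z₁)
    (h₁ : ∀ j ∈ V, h (z₁ - t₁) + μ j * Real.exp (-t₁) + ∑ i ∈ W \ {j}, μ i < 1)
    (hn : h (z - V.card * t) + (∑ j ∈ V, μ j) * Real.exp (-t) + ∑ i ∈ W \ V, μ i < 1) :
    h (z₁ - V.card * max t (t₁ / V.card))
      + (∑ j ∈ V, μ j) * Real.exp (-max t (t₁ / V.card)) + ∑ i ∈ W \ V, μ i < 1 := by
  set C := ∑ j ∈ V, μ j with hC
  set R := ∑ i ∈ W \ V, μ i with hR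
  set n : ℝ := (V.card : ℝ) with hnn
  have hnpos : 0 < n := by
    rw [hnn]
    exact_mod_cast hV.card_pos
  have hC0 : 0 ≤ C := Finset.sum_nonneg fun i _ => hμ i
  have havg : h (z₁ - t₁) + C * Real.exp (-(t₁ / n)) + R < 1 := by
    have hrest : ∀ j ∈ V, ∑ i ∈ W \ {j}, μ i = C - μ j + R := by
      intro j hj
      have e1 := Finset.sum_sdiff (f := μ) (Finset.singleton_subset_iff.mpr (hVW hj))
      have e2 := Finset.sum_sdiff (f := μ) hVW
      rw [Finset.sum_singleton] at e1
      linarith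
    have hsum : ∑ j ∈ V, (h (z₁ - t₁) + μ j * Real.exp (-t₁) + (C - μ j + R)) < ∑ j ∈ V, 1 :=
      Finset.sum_lt_sum_of_nonempty hV fun j hj => by
        rw [← hrest j hj]
        exact h₁ j hj
    simp only [Finset.sum_add_distrib, Finset.sum_sub_distrib, ← Finset.sum_mul,
      Finset.sum_const, nsmul_eq_mul, mul_one, ← hC, ← hnn] at hsum
    have hbern : n * Real.exp (-(t₁ / n)) ≤ Real.exp (-t₁) + (n - 1) := by
      have hb := one_add_mul_le_pow (a := Real.exp (-(t₁ / n)) - 1)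
        (by linarith [Real.exp_pos (-(t₁ / n))]) V.card
      rw [add_sub_cancel, ← Real.exp_nat_mul, ← hnn, mul_neg, mul_div_cancel₀ _ hnpos.ne'] at hb
      linarith
    have hCb := mul_le_mul_of_nonneg_left hbern hC0
    have : n * (h (z₁ - t₁) + C * Real.exp (-(t₁ / n)) + R) < n * 1 := by
      nlinarith
    exact lt_of_mul_lt_mul_left this hnpos.le
  rcases le_total t (t₁ / n) with hle | hle
  · rwa [max_eq_right hle, mul_div_cancel₀ _ hnpos.ne']
  · rw [max_eq_left hle]
    have hnt : t₁ ≤ n * t := by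
      rw [div_le_iff₀ hnpos] at hle
      linarith
    have hmax := hconv.le_max_of_mem_Icc (x := z - n * t) (y := z₁ - t₁) (z := z₁ - n * t)
      (Set.mem_univ _) (Set.mem_univ _) ⟨by linarith, by linarith⟩
    have hexp : C * Real.exp (-t) ≤ C * Real.exp (-(t₁ / n)) := by gcongr
    have hlt : max (h (z - n * t)) (h (z₁ - t₁)) < 1 - R - C * Real.exp (-t) :=
      max_lt (by linarith) (by linarith)
    linarith

lemma convexOn_exp_comb (A B D : ℝ) (hA : 0 ≤ A) (hB : 0 ≤ B) :
    ConvexOn ℝ Set.univ fun a => A * Real.exp a + B * Real.exp (-a) + D := by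
  have h1 : ConvexOn ℝ Set.univ fun a : ℝ => A * Real.exp a := by
    simpa using convexOn_exp.smul hA
  have h2 : ConvexOn ℝ Set.univ fun a : ℝ => B * Real.exp (-a) := by
    simpa using
      (convexOn_exp.comp_linearMap (-LinearMap.id : ℝ →ₗ[ℝ] ℝ)).smul hB
  exact (h1.add h2).add_const D

lemma gamma_lt_one_of_interpolation (k : ℕ) (lam : ℝ) (μ : Fin k → ℝ)
    (hlam : 0 < lam) (hμ : ∀ i, 0 < μ i) (U V : Finset (Fin k)) (hU : U.Nonempty)
    (hV : V.Nonempty) (hUV : U ∩ V = ∅) (z₁ t₁ z t : ℝ) (hz : z ≤ z₁)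
    (h₁ : ∀ j ∈ V,
      gammaPlus k lam μ U (Fin.cons z₁ fun i => if i ∈ ({j} : Finset (Fin k)) then t₁ else 0) < 1 ∧
      gammaZero k lam μ U (Fin.cons z₁ fun i => if i ∈ ({j} : Finset (Fin k)) then t₁ else 0) < 1)
    (hn : gammaPlus k lam μ U (Fin.cons z fun i => if i ∈ V then t else 0) < 1 ∧
      gammaZero k lam μ U (Fin.cons z fun i => if i ∈ V then t else 0) < 1) :
    gammaPlus k lam μ U
        (Fin.cons z₁ fun i => if i ∈ V then max t (t₁ / V.card) else 0) < 1 ∧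
      gammaZero k lam μ U
        (Fin.cons z₁ fun i => if i ∈ V then max t (t₁ / V.card) else 0) < 1 := by
  have hsing : ∀ j ∈ V, U ∩ {j} = ∅ := fun j hj => by
    rw [← Finset.subset_empty, ← hUV]
    exact Finset.inter_subset_inter_left (Finset.singleton_subset_iff.mpr hj)
  have hVU : V ⊆ Uᶜ := fun j hj => Finset.mem_compl.mpr fun h => by
    simpa [hUV] using Finset.mem_inter.mpr ⟨h, hj⟩
  have hB : 0 ≤ ∑ i ∈ U, μ i := Finset.sum_nonneg fun i _ => (hμ i).le
  rw [gammaPlus_cons k lam μ _ _ U V hU hUV, gammaZero_cons k lam μ _ _ U V hU hUV] at hn ⊢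
  constructor
  · refine drift_interpolation
      (fun a => (if U.card = 1 then lam * Real.exp a else lam)
        + (∑ i ∈ U, μ i) * Real.exp (-a)) ?_ μ (fun i => (hμ i).le) V Uᶜ hV hVU z₁ t₁ z t hz
      (fun j hj => ?_) hn.1
    · split_ifs
      · simpa using convexOn_exp_comb lam _ 0 hlam.le hB
      · simpa [add_comm] using convexOn_exp_comb 0 _ lam le_rfl hB
    · have := (h₁ j hj).1
      rw [gammaPlus_cons k lam μ _ _ U {j} hU (hsing j hj)] at this
      simpa using this
  · refine drift_interpolation
      (fun a => (if U.card = 1 then lam * Real.exp a else lam) + (∑ i ∈ U, μ i))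
      ?_ μ (fun i => (hμ i).le) V Uᶜ hV hVU z₁ t₁ z t hz (fun j hj => ?_) hn.2
    · split_ifs
      · simpa using convexOn_exp_comb lam 0 (∑ i ∈ U, μ i) hlam.le le_rfl
      · exact convexOn_const _ convex_univ
    · have := (h₁ j hj).2
      rw [gammaZero_cons k lam μ _ _ U {j} hU (hsing j hj)] at this
      simpa using this

/-- If at least two queues are tied outside `{j}`, an arrival does not change the test
function, so a negative drift on the boundary forces its exponent to be positive. -/
lemma pos_of_gammaZero_lt_one (k : ℕ) (hk : 3 ≤ k) (lam : ℝ) (μ : Fin k → ℝ)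
    (hμ : ∀ i, 0 < μ i) (hnorm : lam + ∑ i, μ i = 1) (z t : ℝ) (j : Fin k)
    (h : gammaZero k lam μ ({j}ᶜ)
      (Fin.cons z fun i => if i ∈ ({j} : Finset (Fin k)) then t else 0) < 1) : 0 < t := by
  have hcard : (({j}ᶜ : Finset (Fin k))).card = k - 1 := by simp [Finset.card_compl]
  have hne : (({j}ᶜ : Finset (Fin k))).Nonempty := by
    rw [← Finset.card_pos]
    omega
  rw [gammaZero_cons k lam μ _ _ _ _ hne (by simp), if_neg (by omega)] at h
  have hsum := Finset.sum_compl_add_sum {j} μ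
  simp only [Finset.sum_singleton, compl_compl, Finset.sdiff_self, Finset.sum_empty] at h hsum
  by_contra ht
  have : (1 : ℝ) ≤ Real.exp (-t) := Real.one_le_exp (by linarith)
  nlinarith [hμ j]

lemma phi_cons_lt_top (k : ℕ) (lam : ℝ) (μ : Fin k → ℝ)
    (hlam : 0 < lam) (hμ : ∀ i, 0 < μ i) (hnorm : lam + ∑ i, μ i = 1)
    (π : ℕ × (Fin k → ℕ) → ℝ) (hπnn : ∀ s, 0 ≤ π s)
    (hπsupp : ∀ s, π s ≠ 0 → ∃ i : Fin k, s.2 i = 0) (hπsum : HasSum π 1)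
    (hπstat : ∀ s', (∑' s, π s * jsqP k lam μ s s') = π s')
    (z : ℝ) (τ : ℕ → ℝ)
    (hτ : ∀ n, 1 ≤ n → n + 1 ≤ k - 1 → τ (n + 1) ≤ τ n)
    (hC1 : ∀ V : Finset (Fin k), V.Nonempty → V.card ≤ k - 1 →
      ∀ U : Finset (Fin k), U.Nonempty → U ∩ V = ∅ →
        gammaPlus k lam μ U (Fin.cons z fun i => if i ∈ V then τ V.card else 0) < 1 ∧
        gammaZero k lam μ U (Fin.cons z fun i => if i ∈ V then τ V.card else 0) < 1)
    (hC2 : ∀ V : Finset (Fin k), V.card = 1 →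
      ∀ U : Finset (Fin k), U.Nonempty → (U ∩ V).Nonempty →
        phiPlus k π U (Fin.cons z fun i => if i ∈ V then τ V.card else 0) < ⊤)
    (n : ℕ) (hn : 1 ≤ n) (hnk : n ≤ k - 1) (V : Finset (Fin k)) (hV : V.card = n) :
    phi k π (Fin.cons z fun i => if i ∈ V then τ n else 0) < ⊤ := by
  classical
  induction n, hn using Nat.le_induction generalizing V with
  | base =>
    refine phi_lt_top_of_drift k lam μ hlam hμ hnorm π hπnn hπsupp hπsum hπstat _ V
      (by simpa [hV] using hC1 V (Finset.card_pos.mp (by omega)) (by omega)) ?_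
    obtain ⟨i, rfl⟩ := Finset.card_eq_one.mp hV
    set θ : Fin (k + 1) → ℝ := Fin.cons z fun j => if j ∈ ({i} : Finset (Fin k)) then τ 1 else 0
      with hθ
    have hfin : (∑ U : Finset (Fin k), if (U ∩ {i}).Nonempty then phiPlus k π U θ else 0)
        + ∑' s, ENNReal.ofReal (π s) < ⊤ := by
      refine ENNReal.add_lt_top.mpr ⟨ENNReal.sum_lt_top.mpr fun U _ => ?_, ?_⟩
      · split_ifs with hU
        · have h := hC2 {i} hV U (hU.mono Finset.inter_subset_left) hU
          rwa [hV] at h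
        · exact ENNReal.zero_lt_top
      · rw [← ENNReal.ofReal_tsum_of_nonneg hπnn hπsum.summable]
        exact ENNReal.ofReal_lt_top
    refine lt_of_le_of_lt ?_ hfin
    have hswap : (∑ U : Finset (Fin k), if (U ∩ {i}).Nonempty then phiPlus k π U θ else 0) =
        ∑' s : ℕ × (Fin k → ℕ), ∑ U : Finset (Fin k), if (U ∩ {i}).Nonempty then
          (if 1 ≤ s.1 ∧ zeroSet k s.2 = U then ENNReal.ofReal (π s * expWeight k θ s) else 0)
          else 0 := by
      rw [Summable.tsum_finsetSum fun _ _ => ENNReal.summable]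
      refine Finset.sum_congr rfl fun U _ => ?_
      split_ifs
      · rfl
      · simp
    rw [hswap, ← ENNReal.tsum_add]
    refine ENNReal.tsum_le_tsum fun s => ?_
    split_ifs with hs
    · rcases Nat.eq_zero_or_pos s.1 with hm | hm
      · have hi : s.2 i = 0 := by
          obtain ⟨j, hj⟩ := hs
          rw [Finset.mem_inter, Finset.mem_singleton] at hj
          rw [← hj.2]
          exact mem_zeroSet.mp hj.1
        have hw : expWeight k θ s = 1 := by
          rw [hθ, expWeight_cons]
          simp [hm, hi]
        rw [hw, mul_one]
        exact le_add_self
      · refine le_trans ?_ (le_trans (Finset.single_le_sum (fun _ _ => zero_le)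
          (Finset.mem_univ (zeroSet k s.2))) le_self_add)
        rw [if_pos hs, if_pos ⟨hm, rfl⟩]
    · exact zero_le
  | succ n hn ih =>
    refine phi_lt_top_of_drift k lam μ hlam hμ hnorm π hπnn hπsupp hπsum hπstat _ V
      (by simpa [hV] using hC1 V (Finset.card_pos.mp (by omega)) (by omega)) ?_
    have hfin : ∑ i ∈ V, phi k π (Fin.cons z fun j => if j ∈ V.erase i then τ n else 0) < ⊤ :=
      ENNReal.sum_lt_top.mpr fun i hi =>
        ih (by omega) _ (by rw [Finset.card_erase_of_mem hi]; omega)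
    refine lt_of_le_of_lt ?_ hfin
    unfold phi
    rw [← Summable.tsum_finsetSum fun _ _ => ENNReal.summable]
    refine ENNReal.tsum_le_tsum fun s => ?_
    split_ifs with hs
    · obtain ⟨i, hi⟩ := hs
      rw [Finset.mem_inter, mem_zeroSet] at hi
      refine le_trans ?_ (Finset.single_le_sum (fun _ _ => zero_le) hi.2)
      refine ENNReal.ofReal_le_ofReal (mul_le_mul_of_nonneg_left ?_ (hπnn s))
      rw [expWeight_cons, expWeight_cons, Real.exp_le_exp,
        ← Finset.add_sum_erase V _ hi.2, hi.1, Nat.cast_zero, zero_add]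
      gcongr
      exact hτ n hn hnk
    · exact zero_le

/-- **Key reduction lemma:** if the `ζ_{i,j}` are nonincreasing in `j` and condition (C1)
holds, then condition (C2) implies `φ(ζ_{0,1}, ζ_{1,k−1}𝟙) < ∞`. -/
theorem jsq_varphi_V_lemma
    (k : ℕ) (hk : 2 ≤ k) (lam : ℝ) (μ : Fin k → ℝ)
    (hlam : 0 < lam) (hμ : ∀ i, 0 < μ i)
    (hnorm : lam + ∑ i, μ i = 1)
    (hρ : rho k lam μ < 1)
    (π : ℕ × (Fin k → ℕ) → ℝ)
    (hπnn : ∀ s, 0 ≤ π s)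
    (hπsupp : ∀ s, π s ≠ 0 → ∃ i : Fin k, s.2 i = 0)
    (hπsum : HasSum π 1)
    (hπstat : ∀ s', (∑' s, π s * jsqP k lam μ s s') = π s')
    (ζ₀ ζ₁ : ℕ → ℝ)
    (hζ₀ : ∀ j m : ℕ, 1 ≤ j → j ≤ m → m ≤ k → ζ₀ m ≤ ζ₀ j)
    (hζ₁ : ∀ j m : ℕ, 1 ≤ j → j ≤ m → m ≤ k → ζ₁ m ≤ ζ₁ j)
    (hC1 : ∀ V : Finset (Fin k), V.Nonempty → V.card ≤ k - 1 →
      ∀ U : Finset (Fin k), U.Nonempty → U ∩ V = ∅ →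
        gammaPlus k lam μ U (zetaVec k ζ₀ ζ₁ V) < 1 ∧
        gammaZero k lam μ U (zetaVec k ζ₀ ζ₁ V) < 1)
    (hC2 : ∀ V : Finset (Fin k), V.card = 1 →
      ∀ U : Finset (Fin k), U.Nonempty → (U ∩ V).Nonempty →
        phiPlus k π U (zetaVec k ζ₀ ζ₁ V) < ⊤) :
    phi k π (Fin.cons (ζ₀ 1) (fun _ => ζ₁ (k - 1))) < ⊤ := by
  classical
  set τ : ℕ → ℝ := fun n => max (ζ₁ n) (ζ₁ 1 / n) with hτdef
  have hτ1 : τ 1 = ζ₁ 1 := by simp [hτdef]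
  have hC1' : ∀ V : Finset (Fin k), V.Nonempty → V.card ≤ k - 1 →
      ∀ U : Finset (Fin k), U.Nonempty → U ∩ V = ∅ →
        gammaPlus k lam μ U (Fin.cons (ζ₀ 1) fun i => if i ∈ V then τ V.card else 0) < 1 ∧
        gammaZero k lam μ U (Fin.cons (ζ₀ 1) fun i => if i ∈ V then τ V.card else 0) < 1 := by
    intro V hV hVk U hU hUV
    refine gamma_lt_one_of_interpolation k lam μ hlam hμ U V hU hV hUV (ζ₀ 1) (ζ₁ 1)
      (ζ₀ V.card) (ζ₁ V.card) (hζ₀ 1 V.card le_rfl hV.card_pos (by omega)) (fun j hj => ?_)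
      (hC1 V hV hVk U hU hUV)
    refine hC1 {j} (Finset.singleton_nonempty j) (by simp; omega) U hU ?_
    rw [← Finset.subset_empty, ← hUV]
    exact Finset.inter_subset_inter_left (Finset.singleton_subset_iff.mpr hj)
  have hτanti : ∀ n, 1 ≤ n → n + 1 ≤ k - 1 → τ (n + 1) ≤ τ n := by
    intro n hn hnk
    have hpos : 0 < ζ₁ 1 := by
      let j : Fin k := ⟨0, by omega⟩
      refine pos_of_gammaZero_lt_one k (by omega) lam μ hμ hnorm (ζ₀ 1) (ζ₁ 1) j ?_
      refine (hC1 {j} (Finset.singleton_nonempty j) (by simp; omega) {j}ᶜ ?_ (by simp)).2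
      rw [← Finset.card_pos, Finset.card_compl]
      simp
      omega
    have hn0 : (0 : ℝ) < n := by exact_mod_cast hn
    refine max_le_max (hζ₁ n (n + 1) hn (by omega) (by omega)) ?_
    gcongr
    omega
  have hC2' : ∀ V : Finset (Fin k), V.card = 1 →
      ∀ U : Finset (Fin k), U.Nonempty → (U ∩ V).Nonempty →
        phiPlus k π U (Fin.cons (ζ₀ 1) fun i => if i ∈ V then τ V.card else 0) < ⊤ := by
    intro V hV U hU hUV
    have h := hC2 V hV U hU hUV
    rw [hV, hτ1]
    rwa [zetaVec, hV] at h
  have hfin : ∑ i : Fin k, phi k π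
      (Fin.cons (ζ₀ 1) fun j => if j ∈ Finset.univ.erase i then τ (k - 1) else 0) < ⊤ :=
    ENNReal.sum_lt_top.mpr fun i _ =>
      phi_cons_lt_top k lam μ hlam hμ hnorm π hπnn hπsupp hπsum hπstat (ζ₀ 1) τ hτanti hC1'
        hC2' (k - 1) (by omega) le_rfl _ (by simp [Finset.card_erase_of_mem])
  refine lt_of_le_of_lt ?_ hfin
  unfold phi
  rw [← Summable.tsum_finsetSum fun _ _ => ENNReal.summable]
  refine ENNReal.tsum_le_tsum fun s => ?_
  by_cases hs : π s = 0
  · simp [hs]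
  obtain ⟨i, hi⟩ := hπsupp s hs
  refine le_trans ?_ (Finset.single_le_sum (fun _ _ => zero_le) (Finset.mem_univ i))
  refine ENNReal.ofReal_le_ofReal (mul_le_mul_of_nonneg_left ?_ (hπnn s))
  have hw := expWeight_cons k (ζ₀ 1) (ζ₁ (k - 1)) Finset.univ s
  simp only [Finset.mem_univ, if_true] at hw
  rw [hw, expWeight_cons, Real.exp_le_exp, ← Finset.add_sum_erase _ _ (Finset.mem_univ i), hi,
    Nat.cast_zero, zero_add]
  gcongr
  exact le_max_left _ _
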